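/- arXiv:2602.21164 — 5 statements merged into one kernel-verified Lean document; each statement's English description precedes it below -/
import Mathlib

section
/- Let m, M > 0, let ū ∈ C^0(Ω̄) satisfy m ≤ ū(x) ≤ M for all x ∈ Ω̄, let g ∈ C^0(Ω̄) be nonnegative, and let v ∈ C^2(Ω̄) satisfy −v''(x) + ū(x) v(x) = g(x) for all x ∈ Ω and v'(0) = v'(L) = 0. Then 0 ≤ v(x) ≤ (sup_{Ω̄} g)/m for all x ∈ Ω̄, and moreover |v'(x)| ≤ L · (sup_{Ω̄} g) · (1 + M/m) for all x ∈ Ω̄. -/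
open Set MeasureTheory

/-- One-dimensional second-order condition with Neumann boundary values: at a minimum over
`[a, b]` the second derivative is nonnegative, also when the minimum is an endpoint. -/
theorem second_deriv_nonneg_of_isMinOn {a b : ℝ} (hab : a < b) {w d dd : ℝ → ℝ}
    (hw : ∀ x ∈ Icc a b, HasDerivWithinAt w (d x) (Icc a b) x)
    (hd : ∀ x ∈ Icc a b, HasDerivWithinAt d (dd x) (Icc a b) x)
    (ha : d a = 0) (hb : d b = 0) {x : ℝ} (hx : x ∈ Icc a b) (hmin : IsMinOn w (Icc a b) x) :
    0 ≤ dd x := by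
  have hint : ∀ y ∈ Ioo a b, HasDerivAt w (d y) y := fun y hy =>
    (hw y (Ioo_subset_Icc_self hy)).hasDerivAt (Icc_mem_nhds hy.1 hy.2)
  have hcrit : d x = 0 := by
    rcases hx.1.eq_or_lt with h | h
    · rwa [← h]
    rcases hx.2.eq_or_lt with h' | h'
    · rwa [h']
    exact (hmin.isLocalMin (Icc_mem_nhds h h')).hasDerivAt_eq_zero (hint x ⟨h, h'⟩)
  have hcont : ContinuousOn w (Icc a b) := fun y hy => (hw y hy).continuousWithinAt
  by_contra! hneg
  have hslope := (hasDerivWithinAt_iff_tendsto_slope.1 (hd x hx)).eventually (gt_mem_nhds hneg)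
  obtain ⟨ε, hε, hball⟩ := Metric.mem_nhdsWithin_iff.1 hslope
  have key : ∀ y ∈ Icc a b, y ≠ x → |y - x| < ε → (y - x)⁻¹ * d y < 0 := by
    intro y hy hne hlt
    have h : slope d x y < 0 := hball ⟨by rwa [Metric.mem_ball, Real.dist_eq], hy, hne⟩
    simpa [slope, hcrit] using h
  rcases hx.2.eq_or_lt with h | h
  · obtain ⟨y, hy⟩ : ∃ y, max a (x - ε) < y ∧ y < x :=
      exists_between (max_lt (h ▸ hab) (by linarith))
    have hay := (le_max_left a (x - ε)).trans_lt hy.1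
    have hεy := (le_max_right a (x - ε)).trans_lt hy.1
    obtain ⟨c, hc, hcw⟩ := exists_hasDerivAt_eq_slope w d hy.2
      (hcont.mono (Icc_subset_Icc hay.le hx.2))
      (fun z hz => hint z ⟨hay.trans hz.1, hz.2.trans_le hx.2⟩)
    have hk := key c ⟨(hay.trans hc.1).le, hc.2.le.trans hx.2⟩ hc.2.ne
      (by rw [abs_lt]; constructor <;> linarith [hc.1, hc.2])
    have hpos : 0 < d c := pos_of_mul_neg_right hk (inv_nonpos.2 (by linarith [hc.2]))
    rw [hcw] at hpos
    have := (div_pos_iff_of_pos_right (sub_pos.2 hy.2)).1 hpos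
    have hle : w x ≤ w y := hmin ⟨hay.le, hy.2.le.trans hx.2⟩
    linarith
  · obtain ⟨y, hy⟩ : ∃ y, x < y ∧ y < min b (x + ε) :=
      exists_between (lt_min h (by linarith))
    have hyb := hy.2.trans_le (min_le_left b (x + ε))
    have hyε := hy.2.trans_le (min_le_right b (x + ε))
    obtain ⟨c, hc, hcw⟩ := exists_hasDerivAt_eq_slope w d hy.1
      (hcont.mono (Icc_subset_Icc hx.1 hyb.le))
      (fun z hz => hint z ⟨hx.1.trans_lt hz.1, hz.2.trans hyb⟩)
    have hk := key c ⟨hx.1.trans hc.1.le, (hc.2.trans hyb).le⟩ hc.1.ne'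
      (by rw [abs_lt]; constructor <;> linarith [hc.1, hc.2])
    have hlt : d c < 0 := neg_of_mul_neg_right hk (inv_nonneg.2 (by linarith [hc.1]))
    rw [hcw] at hlt
    have hle : w x ≤ w y := hmin ⟨hx.1.trans hy.1.le, hyb.le⟩
    have := div_nonneg (sub_nonneg.2 hle) (sub_pos.2 hy.1).le
    linarith

/-- Let `Ω = (0,L)` with `L > 0`. Let `m, M > 0`, let `ubar ∈ C⁰(Ω̄)`
satisfy `m ≤ ubar ≤ M`, let `g ∈ C⁰(Ω̄)` be nonnegative, and let `v ∈ C²(Ω̄)` (with first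
derivative `d` and second derivative `dd` on `Ω̄`) satisfy `-v'' + ubar v = g` in `Ω` and
`v'(0) = v'(L) = 0`.  Then `0 ≤ v ≤ (sup g)/m` on `Ω̄` and `|v'| ≤ L (sup g)(1 + M/m)` on `Ω̄`. -/
theorem stmt_2
    (L : ℝ) (hL : 0 < L)
    (m M : ℝ) (hm : 0 < m) (hM : 0 < M)
    (ubar g v d dd : ℝ → ℝ)
    (hubar_cont : ContinuousOn ubar (Icc 0 L))
    (hubar_bd : ∀ x ∈ Icc 0 L, m ≤ ubar x ∧ ubar x ≤ M)
    (hg_cont : ContinuousOn g (Icc 0 L))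
    (hg_nonneg : ∀ x ∈ Icc 0 L, 0 ≤ g x)
    (hv_cont : ContinuousOn v (Icc 0 L))
    (hd_cont : ContinuousOn d (Icc 0 L))
    (hdd_cont : ContinuousOn dd (Icc 0 L))
    (hv_deriv : ∀ x ∈ Icc 0 L, HasDerivWithinAt v (d x) (Icc 0 L) x)
    (hd_deriv : ∀ x ∈ Icc 0 L, HasDerivWithinAt d (dd x) (Icc 0 L) x)
    (heq : ∀ x ∈ Ioo 0 L, -dd x + ubar x * v x = g x)
    (hbc0 : d 0 = 0) (hbcL : d L = 0) :
    ∀ x ∈ Icc 0 L,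
      (0 ≤ v x ∧ v x ≤ (sSup (g '' Icc 0 L)) / m) ∧
      |d x| ≤ L * (sSup (g '' Icc 0 L)) * (1 + M / m) := by
  have heq' : ∀ x ∈ Icc 0 L, -dd x + ubar x * v x = g x := by
    have h : EqOn (fun x => -dd x + ubar x * v x) g (Icc 0 L) :=
      EqOn.of_subset_closure heq (hdd_cont.neg.add (hubar_cont.mul hv_cont)) hg_cont
        Ioo_subset_Icc_self (closure_Ioo hL.ne).ge
    exact h
  have hne : (Icc 0 L).Nonempty := nonempty_Icc.2 hL.le
  set G := sSup (g '' Icc 0 L)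
  have hgG : ∀ x ∈ Icc 0 L, g x ≤ G := fun x hx =>
    le_csSup (isCompact_Icc.image_of_continuousOn hg_cont).bddAbove (mem_image_of_mem g hx)
  have hnonneg : ∀ x ∈ Icc 0 L, 0 ≤ v x := by
    obtain ⟨y, hy, hmin⟩ := isCompact_Icc.exists_isMinOn hne hv_cont
    have h := second_deriv_nonneg_of_isMinOn hL hv_deriv hd_deriv hbc0 hbcL hy hmin
    have hvy : 0 ≤ v y := nonneg_of_mul_nonneg_right
      (by linarith [heq' y hy, hg_nonneg y hy] : 0 ≤ ubar y * v y)
      (hm.trans_le (hubar_bd y hy).1)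
    exact fun x hx => hvy.trans (hmin hx)
  have hupper : ∀ x ∈ Icc 0 L, v x ≤ G / m := by
    obtain ⟨y, hy, hmax⟩ := isCompact_Icc.exists_isMaxOn hne hv_cont
    have h := second_deriv_nonneg_of_isMinOn (w := fun x => -v x) (d := fun x => -d x)
      (dd := fun x => -dd x) hL (fun x hx => (hv_deriv x hx).fun_neg)
      (fun x hx => (hd_deriv x hx).fun_neg) (by simp [hbc0]) (by simp [hbcL]) hy hmax.neg
    have hvy : v y ≤ G / m := by
      rw [le_div_iff₀' hm]
      have := mul_le_mul_of_nonneg_right (hubar_bd y hy).1 (hnonneg y hy)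
      linarith [heq' y hy, hgG y hy]
    exact fun x hx => (hmax hx).trans hvy
  have hdd_bound : ∀ x ∈ Icc 0 L, ‖dd x‖ ≤ G * (1 + M / m) := by
    intro x hx
    have hv0 := hnonneg x hx
    have hu := hubar_bd x hx
    have h₁ : 0 ≤ ubar x * v x := mul_nonneg (hm.le.trans hu.1) hv0
    have h₂ : ubar x * v x ≤ M * (G / m) := mul_le_mul hu.2 (hupper x hx) hv0 hM.le
    have h₃ : G * (1 + M / m) = G + M * (G / m) := by ring
    rw [Real.norm_eq_abs, abs_le, h₃]
    constructor <;> linarith [heq' x hx, hgG x hx, hg_nonneg x hx]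
  intro x hx
  refine ⟨⟨hnonneg x hx, hupper x hx⟩, ?_⟩
  have h0 : (0 : ℝ) ∈ Icc 0 L := left_mem_Icc.2 hL.le
  have h := (convex_Icc 0 L).norm_image_sub_le_of_norm_hasDerivWithin_le hd_deriv hdd_bound h0 hx
  rw [hbc0, sub_zero, sub_zero, Real.norm_eq_abs, Real.norm_eq_abs, abs_of_nonneg hx.1] at h
  calc |d x| ≤ G * (1 + M / m) * x := h
    _ ≤ G * (1 + M / m) * L :=
      mul_le_mul_of_nonneg_left hx.2 ((norm_nonneg _).trans (hdd_bound 0 h0))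
    _ = L * G * (1 + M / m) := by ring
end

section
/- Under the stationary elliptic hypotheses, the following identity holds: ∫_0^L g(x)/v(x) dx + ∫_0^L (v'(x))²/(v(x))² dx = ∫_0^L u(x) dx. In particular, both terms on the left-hand side are bounded above by ∫_0^L u. -/
open Set MeasureTheory

/-- Under the stationary elliptic hypotheses on `Ω = (0,L)`
(`u, g ≥ 0` continuous on `Ω̄`, `v ∈ C²(Ω̄)` positive with derivative `d` and second
derivative `dd`, satisfying `v'' = u v - g` in `Ω` and `v'(0) = v'(L) = 0`), one has
`∫₀ᴸ g/v + ∫₀ᴸ (v')²/v² = ∫₀ᴸ u`; in particular both terms on the left-hand side are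
bounded above by `∫₀ᴸ u`. -/
theorem stmt_6
    (L : ℝ) (hL : 0 < L)
    (u g v d dd : ℝ → ℝ)
    (hu_cont : ContinuousOn u (Icc 0 L)) (hu_nonneg : ∀ x ∈ Icc 0 L, 0 ≤ u x)
    (hg_cont : ContinuousOn g (Icc 0 L)) (hg_nonneg : ∀ x ∈ Icc 0 L, 0 ≤ g x)
    (hv_cont : ContinuousOn v (Icc 0 L))
    (hd_cont : ContinuousOn d (Icc 0 L))
    (hdd_cont : ContinuousOn dd (Icc 0 L))
    (hv_deriv : ∀ x ∈ Icc 0 L, HasDerivWithinAt v (d x) (Icc 0 L) x)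
    (hd_deriv : ∀ x ∈ Icc 0 L, HasDerivWithinAt d (dd x) (Icc 0 L) x)
    (hv_pos : ∀ x ∈ Icc 0 L, 0 < v x)
    (heq : ∀ x ∈ Ioo 0 L, dd x = u x * v x - g x)
    (hbc0 : d 0 = 0) (hbcL : d L = 0) :
    (∫ x in (0:ℝ)..L, g x / v x) + (∫ x in (0:ℝ)..L, (d x) ^ 2 / (v x) ^ 2)
        = ∫ x in (0:ℝ)..L, u x ∧
      (∫ x in (0:ℝ)..L, g x / v x) ≤ ∫ x in (0:ℝ)..L, u x ∧
      (∫ x in (0:ℝ)..L, (d x) ^ 2 / (v x) ^ 2) ≤ ∫ x in (0:ℝ)..L, u x := by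
  have hle : (0 : ℝ) ≤ L := hL.le
  have hv_ne : ∀ x ∈ Icc 0 L, v x ≠ 0 := fun x hx => (hv_pos x hx).ne'
  have hu_int : IntervalIntegrable u volume 0 L :=
    hu_cont.intervalIntegrable_of_Icc hle
  have hg_int : IntervalIntegrable (fun x => g x / v x) volume 0 L :=
    (hg_cont.div hv_cont hv_ne).intervalIntegrable_of_Icc hle
  have hd_int : IntervalIntegrable (fun x => (d x) ^ 2 / (v x) ^ 2) volume 0 L :=
    ((hd_cont.pow 2).div (hv_cont.pow 2)
      fun x hx => pow_ne_zero 2 (hv_ne x hx)).intervalIntegrable_of_Icc hle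
  have hderiv : ∀ x ∈ Ioo 0 L, HasDerivAt (fun y => d y / v y)
      (u x - (g x / v x + (d x) ^ 2 / (v x) ^ 2)) x := by
    intro x hx
    have hx' := Ioo_subset_Icc_self hx
    have hnhds := Icc_mem_nhds hx.1 hx.2
    have hvx := hv_ne x hx'
    refine (((hd_deriv x hx').hasDerivAt hnhds).fun_div
      ((hv_deriv x hx').hasDerivAt hnhds) hvx).congr_deriv ?_
    rw [heq x hx]
    field_simp
    ring
  have hftc := intervalIntegral.integral_eq_sub_of_hasDerivAt_of_le hle
    (hd_cont.div hv_cont hv_ne) hderiv (hu_int.sub (hg_int.add hd_int))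
  rw [intervalIntegral.integral_sub hu_int (hg_int.add hd_int),
    intervalIntegral.integral_add hg_int hd_int] at hftc
  simp only [Pi.div_apply, hbc0, hbcL, zero_div, sub_zero] at hftc
  have hg_nn : 0 ≤ ∫ x in (0:ℝ)..L, g x / v x :=
    intervalIntegral.integral_nonneg hle fun x hx =>
      div_nonneg (hg_nonneg x hx) (hv_pos x hx).le
  have hd_nn : 0 ≤ ∫ x in (0:ℝ)..L, (d x) ^ 2 / (v x) ^ 2 :=
    intervalIntegral.integral_nonneg hle fun x _ => by positivity
  refine ⟨?_, ?_, ?_⟩ <;> linarith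
end

section
/- Under the stationary elliptic hypotheses, the logarithmic derivative of v satisfies the pointwise bound |v'(x)| ≤ v(x) · ( ∫_0^L u(y) dy + ∫_0^L g(y)/v(y) dy ) for all x ∈ Ω̄. -/
open Set MeasureTheory

/-- The logarithmic derivative `q = d / v` of a positive solution of `v'' = u v - g` with `g ≥ 0`
satisfies `q' ≤ u`, so its increments are controlled by the integral of `u`. -/
theorem logDeriv_sub_le_integral {a b : ℝ} (hab : a ≤ b) {u g v d dd : ℝ → ℝ}
    (hu : ContinuousOn u (Icc a b)) (hg : ∀ x ∈ Icc a b, 0 ≤ g x)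
    (hv : ∀ x ∈ Icc a b, HasDerivWithinAt v (d x) (Icc a b) x)
    (hd : ∀ x ∈ Icc a b, HasDerivWithinAt d (dd x) (Icc a b) x)
    (hpos : ∀ x ∈ Icc a b, 0 < v x)
    (heq : ∀ x ∈ Ioo a b, dd x = u x * v x - g x) :
    d b / v b - d a / v a ≤ ∫ y in a..b, u y := by
  have hq : ∀ x ∈ Icc a b, HasDerivWithinAt (fun y => d y / v y)
      ((dd x * v x - d x * d x) / v x ^ 2) (Icc a b) x := fun x hx =>
    (hd x hx).fun_div (hv x hx) (hpos x hx).ne'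
  refine intervalIntegral.sub_le_integral_of_hasDeriv_right_of_le hab
    (fun x hx => (hq x hx).continuousWithinAt)
    (fun x hx => ((hq x (Ioo_subset_Icc_self hx)).hasDerivAt
      (Icc_mem_nhds hx.1 hx.2)).hasDerivWithinAt)
    hu.integrableOn_Icc fun x hx => ?_
  have hx' := Ioo_subset_Icc_self hx
  have hvx := hpos x hx'
  rw [div_le_iff₀ (by positivity), heq x hx]
  nlinarith [mul_nonneg (hg x hx') hvx.le, mul_self_nonneg (d x)]

/-- Under the stationary elliptic hypotheses on `Ω = (0,L)`, the
logarithmic derivative of `v` satisfies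
`|v'(x)| ≤ v(x) · (∫₀ᴸ u + ∫₀ᴸ g/v)` for all `x ∈ Ω̄`. -/
theorem stmt_7
    (L : ℝ) (hL : 0 < L)
    (u g v d dd : ℝ → ℝ)
    (hu_cont : ContinuousOn u (Icc 0 L)) (hu_nonneg : ∀ x ∈ Icc 0 L, 0 ≤ u x)
    (hg_cont : ContinuousOn g (Icc 0 L)) (hg_nonneg : ∀ x ∈ Icc 0 L, 0 ≤ g x)
    (hv_cont : ContinuousOn v (Icc 0 L))
    (hd_cont : ContinuousOn d (Icc 0 L))
    (hdd_cont : ContinuousOn dd (Icc 0 L))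
    (hv_deriv : ∀ x ∈ Icc 0 L, HasDerivWithinAt v (d x) (Icc 0 L) x)
    (hd_deriv : ∀ x ∈ Icc 0 L, HasDerivWithinAt d (dd x) (Icc 0 L) x)
    (hv_pos : ∀ x ∈ Icc 0 L, 0 < v x)
    (heq : ∀ x ∈ Ioo 0 L, dd x = u x * v x - g x)
    (hbc0 : d 0 = 0) (hbcL : d L = 0) :
    ∀ x ∈ Icc 0 L,
      |d x| ≤ v x * ((∫ y in (0:ℝ)..L, u y) + ∫ y in (0:ℝ)..L, g y / v y) := by
  intro x hx
  have hl : Icc 0 x ⊆ Icc 0 L := Icc_subset_Icc_right hx.2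
  have hr : Icc x L ⊆ Icc 0 L := Icc_subset_Icc_left hx.1
  have hleft := logDeriv_sub_le_integral hx.1 (hu_cont.mono hl) (fun y hy => hg_nonneg y (hl hy))
    (fun y hy => (hv_deriv y (hl hy)).mono hl) (fun y hy => (hd_deriv y (hl hy)).mono hl)
    (fun y hy => hv_pos y (hl hy)) (fun y hy => heq y (Ioo_subset_Ioo_right hx.2 hy))
  have hright := logDeriv_sub_le_integral hx.2 (hu_cont.mono hr) (fun y hy => hg_nonneg y (hr hy))
    (fun y hy => (hv_deriv y (hr hy)).mono hr) (fun y hy => (hd_deriv y (hr hy)).mono hr)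
    (fun y hy => hv_pos y (hr hy)) (fun y hy => heq y (Ioo_subset_Ioo_left hx.1 hy))
  have hsplit : (∫ y in (0:ℝ)..x, u y) + ∫ y in x..L, u y = ∫ y in (0:ℝ)..L, u y :=
    intervalIntegral.integral_add_adjacent_intervals
      ((hu_cont.mono hl).intervalIntegrable_of_Icc hx.1)
      ((hu_cont.mono hr).intervalIntegrable_of_Icc hx.2)
  have hul : 0 ≤ ∫ y in (0:ℝ)..x, u y :=
    intervalIntegral.integral_nonneg hx.1 fun y hy => hu_nonneg y (hl hy)
  have hur : 0 ≤ ∫ y in x..L, u y :=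
    intervalIntegral.integral_nonneg hx.2 fun y hy => hu_nonneg y (hr hy)
  have hgv : 0 ≤ ∫ y in (0:ℝ)..L, g y / v y :=
    intervalIntegral.integral_nonneg hL.le fun y hy =>
      div_nonneg (hg_nonneg y hy) (hv_pos y hy).le
  rw [hbc0, zero_div, sub_zero] at hleft
  rw [hbcL, zero_div, zero_sub] at hright
  have hvx := hv_pos x hx
  rw [← div_le_iff₀' hvx, ← abs_of_pos hvx, ← abs_div, abs_le]
  constructor <;> linarith
end

section
/- (Harnack-type inequality.) Under the stationary elliptic hypotheses, for all x, y ∈ Ω̄ one has v(x) ≤ exp( L · ( ∫_0^L u + ∫_0^L g/v ) ) · v(y). In particular, sup_{Ω̄} v ≤ C · inf_{Ω̄} v with C = exp( L · ( ∫_0^L u + ∫_0^L g/v ) ). -/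
open Set MeasureTheory

/-- If `w` vanishes at both ends of `[0, L]` and `w' ≤ u` inside with `u ≥ 0`, then `|w|` is
bounded by the integral of `u`. -/
theorem abs_le_integral_of_deriv_le {L : ℝ} (hL : 0 < L) {u w w' : ℝ → ℝ}
    (hu : ContinuousOn u (Icc 0 L)) (hu_nonneg : ∀ x ∈ Icc 0 L, 0 ≤ u x)
    (hw : ContinuousOn w (Icc 0 L)) (hw' : ∀ x ∈ Ioo 0 L, HasDerivAt w (w' x) x)
    (hle : ∀ x ∈ Ioo 0 L, w' x ≤ u x) (hw0 : w 0 = 0) (hwL : w L = 0) :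
    ∀ x ∈ Icc 0 L, |w x| ≤ ∫ z in (0:ℝ)..L, u z := by
  have hint : ∀ a ∈ Icc 0 L, ∀ b ∈ Icc 0 L, IntervalIntegrable u volume a b :=
    fun a ha b hb => (hu.mono (uIcc_subset_Icc ha hb)).intervalIntegrable
  have h0 : (0:ℝ) ∈ Icc 0 L := left_mem_Icc.2 hL.le
  have hLm : L ∈ Icc 0 L := right_mem_Icc.2 hL.le
  have hmono : MonotoneOn (fun x => (∫ z in (0:ℝ)..x, u z) - w x) (Icc 0 L) := by
    have hderiv : ∀ x ∈ Ioo 0 L,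
        HasDerivAt (fun x => (∫ z in (0:ℝ)..x, u z) - w x) (u x - w' x) x := by
      intro x hx
      refine HasDerivAt.sub ?_ (hw' x hx)
      refine intervalIntegral.integral_hasDerivAt_right (hint 0 h0 x (Ioo_subset_Icc_self hx))
        ((hu.mono Ioo_subset_Icc_self).stronglyMeasurableAtFilter isOpen_Ioo x hx)
        (hu.continuousAt (Icc_mem_nhds hx.1 hx.2))
    refine monotoneOn_of_deriv_nonneg (convex_Icc 0 L) (ContinuousOn.sub ?_ hw) ?_ ?_
    · have := intervalIntegral.continuousOn_primitive_interval (μ := volume) (f := u)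
        (a := 0) (b := L) (by rw [uIcc_of_le hL.le]; exact hu.integrableOn_Icc)
      rwa [uIcc_of_le hL.le] at this
    · rw [interior_Icc]
      exact fun x hx => (hderiv x hx).differentiableAt.differentiableWithinAt
    · rw [interior_Icc]
      intro x hx
      rw [(hderiv x hx).deriv]
      exact sub_nonneg.2 (hle x hx)
  intro x hx
  have hlow := hmono h0 hx hx.1
  have hupp := hmono hx hLm hx.2
  have hleft : 0 ≤ ∫ z in (0:ℝ)..x, u z :=
    intervalIntegral.integral_nonneg hx.1 fun z hz => hu_nonneg z ⟨hz.1, hz.2.trans hx.2⟩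
  have hright : 0 ≤ ∫ z in x..L, u z :=
    intervalIntegral.integral_nonneg hx.2 fun z hz => hu_nonneg z ⟨hx.1.trans hz.1, hz.2⟩
  have hadd := intervalIntegral.integral_add_adjacent_intervals (hint 0 h0 x hx) (hint x hx L hLm)
  simp only [intervalIntegral.integral_same, hw0, hwL] at hlow hupp
  rw [abs_le]
  constructor <;> linarith

/-- **Harnack-type inequality.** Under the stationary elliptic hypotheses on
`Ω = (0,L)`, for all `x, y ∈ Ω̄` one has
`v(x) ≤ exp(L (∫₀ᴸ u + ∫₀ᴸ g/v)) v(y)`; in particular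
`sup v ≤ exp(L (∫₀ᴸ u + ∫₀ᴸ g/v)) · inf v` on `Ω̄`. -/
theorem stmt_8
    (L : ℝ) (hL : 0 < L)
    (u g v d dd : ℝ → ℝ)
    (hu_cont : ContinuousOn u (Icc 0 L)) (hu_nonneg : ∀ x ∈ Icc 0 L, 0 ≤ u x)
    (hg_cont : ContinuousOn g (Icc 0 L)) (hg_nonneg : ∀ x ∈ Icc 0 L, 0 ≤ g x)
    (hv_cont : ContinuousOn v (Icc 0 L))
    (hd_cont : ContinuousOn d (Icc 0 L))
    (hdd_cont : ContinuousOn dd (Icc 0 L))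
    (hv_deriv : ∀ x ∈ Icc 0 L, HasDerivWithinAt v (d x) (Icc 0 L) x)
    (hd_deriv : ∀ x ∈ Icc 0 L, HasDerivWithinAt d (dd x) (Icc 0 L) x)
    (hv_pos : ∀ x ∈ Icc 0 L, 0 < v x)
    (heq : ∀ x ∈ Ioo 0 L, dd x = u x * v x - g x)
    (hbc0 : d 0 = 0) (hbcL : d L = 0) :
    (∀ x ∈ Icc 0 L, ∀ y ∈ Icc 0 L,
      v x ≤ Real.exp (L * ((∫ z in (0:ℝ)..L, u z) + ∫ z in (0:ℝ)..L, g z / v z)) * v y) ∧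
    sSup (v '' Icc 0 L)
      ≤ Real.exp (L * ((∫ z in (0:ℝ)..L, u z) + ∫ z in (0:ℝ)..L, g z / v z))
        * sInf (v '' Icc 0 L) := by
  have hw_bound : ∀ x ∈ Icc 0 L, |d x / v x| ≤ ∫ z in (0:ℝ)..L, u z := by
    refine abs_le_integral_of_deriv_le hL (w := fun x => d x / v x)
      (w' := fun x => (dd x * v x - d x * d x) / v x ^ 2) hu_cont hu_nonneg
      (hd_cont.div hv_cont fun x hx => (hv_pos x hx).ne') ?_ ?_ (by simp [hbc0]) (by simp [hbcL])
    · intro x hx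
      have hxI := Ioo_subset_Icc_self hx
      have hnhds := Icc_mem_nhds hx.1 hx.2
      exact ((hd_deriv x hxI).hasDerivAt hnhds).div ((hv_deriv x hxI).hasDerivAt hnhds)
        (hv_pos x hxI).ne'
    · intro x hx
      have hxI := Ioo_subset_Icc_self hx
      have hv := hv_pos x hxI
      change (dd x * v x - d x * d x) / v x ^ 2 ≤ u x
      rw [heq x hx, div_le_iff₀ (by positivity)]
      nlinarith [mul_nonneg (hg_nonneg x hxI) hv.le, mul_self_nonneg (d x)]
  have hg_int : 0 ≤ ∫ z in (0:ℝ)..L, g z / v z :=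
    intervalIntegral.integral_nonneg hL.le fun z hz => div_nonneg (hg_nonneg z hz) (hv_pos z hz).le
  set K := (∫ z in (0:ℝ)..L, u z) + ∫ z in (0:ℝ)..L, g z / v z with hK
  have hmain : ∀ x ∈ Icc 0 L, ∀ y ∈ Icc 0 L, v x ≤ Real.exp (L * K) * v y := by
    intro x hx y hy
    have hlog : ‖Real.log (v x) - Real.log (v y)‖ ≤ K * ‖x - y‖ :=
      (convex_Icc 0 L).norm_image_sub_le_of_norm_hasDerivWithin_le
        (fun z hz => (hv_deriv z hz).log (hv_pos z hz).ne')
        (fun z hz => (hw_bound z hz).trans (by linarith)) hy hx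
    have hK0 : 0 ≤ K := by linarith [(abs_nonneg _).trans (hw_bound x hx)]
    have hxy : ‖x - y‖ ≤ L := by
      rw [Real.norm_eq_abs, abs_le]
      constructor <;> linarith [hx.1, hx.2, hy.1, hy.2]
    have hle : Real.log (v x) ≤ L * K + Real.log (v y) := by
      have h₁ := (le_abs_self _).trans hlog
      have h₂ := mul_le_mul_of_nonneg_left hxy hK0
      linarith
    calc v x = Real.exp (Real.log (v x)) := (Real.exp_log (hv_pos x hx)).symm
      _ ≤ Real.exp (L * K + Real.log (v y)) := Real.exp_le_exp.2 hle
      _ = Real.exp (L * K) * v y := by rw [Real.exp_add, Real.exp_log (hv_pos y hy)]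
  refine ⟨hmain, ?_⟩
  have hne : (v '' Icc 0 L).Nonempty := (nonempty_Icc.2 hL.le).image v
  refine csSup_le hne ?_
  rintro _ ⟨x, hx, rfl⟩
  rw [← div_le_iff₀' (Real.exp_pos _)]
  refine le_csInf hne ?_
  rintro _ ⟨y, hy, rfl⟩
  rw [div_le_iff₀' (Real.exp_pos _)]
  exact hmain x hx y hy
end

section
/- Under the stationary elliptic hypotheses, suppose in addition that 0 < m ≤ ∫_0^L u ≤ M for some constants m, M. Then inf_{Ω̄} v ≤ ( ∫_0^L g ) / m and sup_{Ω̄} v ≥ ( ∫_0^L g ) / M. -/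
open Set MeasureTheory

/-- Under the stationary elliptic hypotheses on `Ω = (0,L)`, if in
addition `0 < m ≤ ∫₀ᴸ u ≤ M`, then `inf_{Ω̄} v ≤ (∫₀ᴸ g)/m` and
`sup_{Ω̄} v ≥ (∫₀ᴸ g)/M`. -/
theorem stmt_9
    (L : ℝ) (hL : 0 < L)
    (u g v d dd : ℝ → ℝ)
    (hu_cont : ContinuousOn u (Icc 0 L)) (hu_nonneg : ∀ x ∈ Icc 0 L, 0 ≤ u x)
    (hg_cont : ContinuousOn g (Icc 0 L)) (hg_nonneg : ∀ x ∈ Icc 0 L, 0 ≤ g x)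
    (hv_cont : ContinuousOn v (Icc 0 L))
    (hd_cont : ContinuousOn d (Icc 0 L))
    (hdd_cont : ContinuousOn dd (Icc 0 L))
    (hv_deriv : ∀ x ∈ Icc 0 L, HasDerivWithinAt v (d x) (Icc 0 L) x)
    (hd_deriv : ∀ x ∈ Icc 0 L, HasDerivWithinAt d (dd x) (Icc 0 L) x)
    (hv_pos : ∀ x ∈ Icc 0 L, 0 < v x)
    (heq : ∀ x ∈ Ioo 0 L, dd x = u x * v x - g x)
    (hbc0 : d 0 = 0) (hbcL : d L = 0)
    (m M : ℝ) (hm : 0 < m)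
    (hmu : m ≤ ∫ x in (0:ℝ)..L, u x) (huM : (∫ x in (0:ℝ)..L, u x) ≤ M) :
    sInf (v '' Icc 0 L) ≤ (∫ x in (0:ℝ)..L, g x) / m ∧
      (∫ x in (0:ℝ)..L, g x) / M ≤ sSup (v '' Icc 0 L) := by
  have hui : IntervalIntegrable u volume 0 L := hu_cont.intervalIntegrable_of_Icc hL.le
  have hgi : IntervalIntegrable g volume 0 L := hg_cont.intervalIntegrable_of_Icc hL.le
  have huvi : IntervalIntegrable (fun x => u x * v x) volume 0 L :=
    (hu_cont.mul hv_cont).intervalIntegrable_of_Icc hL.le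
  have hftc : ∫ x in (0:ℝ)..L, (u x * v x - g x) = d L - d 0 :=
    intervalIntegral.integral_eq_sub_of_hasDerivAt_of_le hL.le hd_cont
      (fun x hx => heq x hx ▸
        (hd_deriv x (Ioo_subset_Icc_self hx)).hasDerivAt (Icc_mem_nhds hx.1 hx.2))
      (huvi.sub hgi)
  have hbalance : ∫ x in (0:ℝ)..L, u x * v x = ∫ x in (0:ℝ)..L, g x := by
    rw [intervalIntegral.integral_sub huvi hgi, hbc0, hbcL] at hftc
    linarith
  have hcompact : IsCompact (v '' Icc 0 L) := isCompact_Icc.image_of_continuousOn hv_cont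
  have hg_int : 0 ≤ ∫ x in (0:ℝ)..L, g x := intervalIntegral.integral_nonneg hL.le hg_nonneg
  have hu_pos : 0 < ∫ x in (0:ℝ)..L, u x := hm.trans_le hmu
  have hlower : (∫ x in (0:ℝ)..L, u x) * sInf (v '' Icc 0 L) ≤ ∫ x in (0:ℝ)..L, g x := by
    rw [← hbalance, ← intervalIntegral.integral_mul_const]
    exact intervalIntegral.integral_mono_on hL.le (hui.mul_const _) huvi fun x hx =>
      mul_le_mul_of_nonneg_left (csInf_le hcompact.bddBelow (mem_image_of_mem v hx))
        (hu_nonneg x hx)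
  have hupper : ∫ x in (0:ℝ)..L, g x ≤ (∫ x in (0:ℝ)..L, u x) * sSup (v '' Icc 0 L) := by
    rw [← hbalance, ← intervalIntegral.integral_mul_const]
    exact intervalIntegral.integral_mono_on hL.le huvi (hui.mul_const _) fun x hx =>
      mul_le_mul_of_nonneg_left (le_csSup hcompact.bddAbove (mem_image_of_mem v hx))
        (hu_nonneg x hx)
  constructor
  · calc sInf (v '' Icc 0 L)
        ≤ (∫ x in (0:ℝ)..L, g x) / ∫ x in (0:ℝ)..L, u x := (le_div_iff₀' hu_pos).2 hlower
      _ ≤ (∫ x in (0:ℝ)..L, g x) / m := div_le_div_of_nonneg_left hg_int hm hmu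
  · calc (∫ x in (0:ℝ)..L, g x) / M
        ≤ (∫ x in (0:ℝ)..L, g x) / ∫ x in (0:ℝ)..L, u x :=
          div_le_div_of_nonneg_left hg_int hu_pos huM
      _ ≤ sSup (v '' Icc 0 L) := (div_le_iff₀' hu_pos).2 hupper
end
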